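/- For any vectors u, v, w, z in ℝ⁸, the Cayley calibration inequality |Ψ(u,v,w,z)| ≤ |u∧v∧w∧z| holds, where |u∧v∧w∧z| denotes the 4-dimensional volume of the parallelepiped spanned by u, v, w, z. -/

import Mathlib

noncomputable section

/-- The octonions `𝕆 ≅ ℝ⁸`, realized as pairs of quaternions via Cayley–Dickson. -/
abbrev Octonion : Type := Quaternion ℝ × Quaternion ℝ

/-- Octonion multiplication (Cayley–Dickson doubling of the quaternions). -/
def omul (p q : Octonion) : Octonion :=
  (p.1 * q.1 - star q.2 * p.2, q.2 * p.1 + p.2 * star q.1)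

/-- Octonion conjugation. -/
def oconj (p : Octonion) : Octonion := (star p.1, -p.2)

/-- The standard inner product on the octonions `≅ ℝ⁸`. -/
def oinner (p q : Octonion) : ℝ := (p.1 * star q.1).re + (p.2 * star q.2).re

/-- The triple cross product `u×v×w = ½(u(v̄w) − w(v̄u))`. -/
def tcross (u v w : Octonion) : Octonion :=
  (2 : ℝ)⁻¹ • (omul u (omul (oconj v) w) - omul w (omul (oconj v) u))

/-- The Cayley 4-form `Ψ(u,v,w,z) = ⟨u×v×w, z⟩`. -/
def cayleyΨ (u v w z : Octonion) : ℝ := oinner (tcross u v w) z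

lemma oinner_eq_inner (p q : Octonion) :
    oinner p q = inner ℝ (WithLp.toLp 2 q) (WithLp.toLp 2 p) := by
  rw [real_inner_comm, WithLp.prod_inner_apply]
  rfl

lemma oinner_comm (p q : Octonion) : oinner p q = oinner q p := by
  simp only [oinner_eq_inner, real_inner_comm]

lemma oinner_add_left (p q r : Octonion) : oinner (p + q) r = oinner p r + oinner q r := by
  simp only [oinner_eq_inner, WithLp.toLp_add, inner_add_right]

lemma oinner_sub_left (p q r : Octonion) : oinner (p - q) r = oinner p r - oinner q r := by
  simp only [oinner_eq_inner, WithLp.toLp_sub, inner_sub_right]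

lemma oinner_smul_left (c : ℝ) (p q : Octonion) : oinner (c • p) q = c * oinner p q := by
  simp only [oinner_eq_inner, WithLp.toLp_smul, inner_smul_right]

lemma oinner_sub_right (p q r : Octonion) : oinner p (q - r) = oinner p q - oinner p r := by
  simp only [oinner_eq_inner, WithLp.toLp_sub, inner_sub_left]

lemma oinner_add_right (p q r : Octonion) : oinner p (q + r) = oinner p q + oinner p r := by
  simp only [oinner_eq_inner, WithLp.toLp_add, inner_add_left]

lemma oinner_smul_right (c : ℝ) (p q : Octonion) : oinner p (c • q) = c * oinner p q := by
  rw [oinner_comm, oinner_smul_left, oinner_comm]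

lemma oinner_self_eq_zero {p : Octonion} : oinner p p = 0 ↔ p = 0 := by
  rw [oinner_eq_inner, inner_self_eq_zero, WithLp.toLp_eq_zero]

lemma det_oinner_nonneg {n : Type*} [Fintype n] [DecidableEq n] (x : n → Octonion) :
    0 ≤ (Matrix.of fun i j => oinner (x i) (x j)).det := by
  have h : (Matrix.of fun i j => oinner (x i) (x j)) =
      Matrix.gram ℝ fun i => WithLp.toLp 2 (x i) := by
    ext i j
    rw [Matrix.of_apply, Matrix.gram_apply, oinner_comm, oinner_eq_inner]
  rw [h]
  exact (Matrix.posSemidef_gram ℝ _).det_nonneg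

lemma oinner_omul_self (p q : Octonion) :
    oinner (omul p q) (omul p q) = oinner p p * oinner q q := by
  simp only [oinner, omul, Quaternion.re_mul, Quaternion.imI_mul, Quaternion.imJ_mul,
    Quaternion.imK_mul, Quaternion.re_star, Quaternion.imI_star, Quaternion.imJ_star,
    Quaternion.imK_star, Quaternion.re_sub, Quaternion.imI_sub, Quaternion.imJ_sub,
    Quaternion.imK_sub, Quaternion.re_add, Quaternion.imI_add, Quaternion.imJ_add,
    Quaternion.imK_add]
  ring

lemma oinner_oconj (p q : Octonion) : oinner (oconj p) (oconj q) = oinner p q := by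
  simp only [oinner, oconj, Quaternion.re_mul, Quaternion.re_star, Quaternion.imI_star,
    Quaternion.imJ_star, Quaternion.imK_star, Quaternion.re_neg, Quaternion.imI_neg,
    Quaternion.imJ_neg, Quaternion.imK_neg]
  ring

lemma omul_oconj_omul_add_swap (u v w : Octonion) :
    omul u (omul (oconj v) w) + omul w (omul (oconj v) u) =
      (2 : ℝ) • (oinner u v • w + oinner v w • u - oinner u w • v) := by
  ext <;>
  simp only [oinner, omul, oconj, Prod.fst_add, Prod.snd_add, Prod.fst_sub, Prod.snd_sub,
    Prod.smul_fst, Prod.smul_snd, Quaternion.re_mul, Quaternion.imI_mul, Quaternion.imJ_mul,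
    Quaternion.imK_mul, Quaternion.re_star, Quaternion.imI_star, Quaternion.imJ_star,
    Quaternion.imK_star, Quaternion.re_sub, Quaternion.imI_sub, Quaternion.imJ_sub,
    Quaternion.imK_sub, Quaternion.re_add, Quaternion.imI_add, Quaternion.imJ_add,
    Quaternion.imK_add, Quaternion.re_neg, Quaternion.imI_neg, Quaternion.imJ_neg,
    Quaternion.imK_neg, Quaternion.re_smul, Quaternion.imI_smul, Quaternion.imJ_smul,
    Quaternion.imK_smul, smul_eq_mul] <;>
  ring

lemma tcross_eq (u v w : Octonion) :
    tcross u v w = omul u (omul (oconj v) w) -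
      (oinner u v • w + oinner v w • u - oinner u w • v) := by
  rw [tcross, eq_sub_of_add_eq' (omul_oconj_omul_add_swap u v w)]
  module

lemma oinner_omul_omul_right (p q r : Octonion) :
    oinner (omul p r) (omul q r) = oinner p q * oinner r r := by
  simp only [oinner, omul, Quaternion.re_mul, Quaternion.imI_mul, Quaternion.imJ_mul,
    Quaternion.imK_mul, Quaternion.re_star, Quaternion.imI_star, Quaternion.imJ_star,
    Quaternion.imK_star, Quaternion.re_sub, Quaternion.imI_sub, Quaternion.imJ_sub,
    Quaternion.imK_sub, Quaternion.re_add, Quaternion.imI_add, Quaternion.imJ_add,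
    Quaternion.imK_add]
  ring

lemma oinner_omul_left (p q r : Octonion) :
    oinner (omul p q) r = oinner q (omul (oconj p) r) := by
  simp only [oinner, omul, oconj, Quaternion.re_mul, Quaternion.imI_mul, Quaternion.imJ_mul,
    Quaternion.imK_mul, Quaternion.re_star, Quaternion.imI_star, Quaternion.imJ_star,
    Quaternion.imK_star, Quaternion.re_sub, Quaternion.imI_sub, Quaternion.imJ_sub,
    Quaternion.imK_sub, Quaternion.re_add, Quaternion.imI_add, Quaternion.imJ_add,
    Quaternion.imK_add, Quaternion.re_neg, Quaternion.imI_neg, Quaternion.imJ_neg,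
    Quaternion.imK_neg]
  ring

lemma oinner_oconj_omul_self (u v w : Octonion) :
    oinner (omul (oconj v) w) (omul (oconj u) u) = oinner u u * oinner v w := by
  simp only [oinner, omul, oconj, Quaternion.re_mul, Quaternion.imI_mul, Quaternion.imJ_mul,
    Quaternion.imK_mul, Quaternion.re_star, Quaternion.imI_star, Quaternion.imJ_star,
    Quaternion.imK_star, Quaternion.re_sub, Quaternion.imI_sub, Quaternion.imJ_sub,
    Quaternion.imK_sub, Quaternion.re_add, Quaternion.imI_add, Quaternion.imJ_add,
    Quaternion.imK_add, Quaternion.re_neg, Quaternion.imI_neg, Quaternion.imJ_neg,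
    Quaternion.imK_neg]
  ring

lemma oinner_tcross_right (u v w : Octonion) : oinner (tcross u v w) w = 0 := by
  rw [tcross_eq, oinner_sub_left, oinner_omul_left, oinner_omul_omul_right, oinner_oconj]
  simp only [oinner_sub_left, oinner_add_left, oinner_smul_left, oinner_comm v u]
  ring

lemma oinner_tcross_left (u v w : Octonion) : oinner (tcross u v w) u = 0 := by
  rw [tcross_eq, oinner_sub_left, oinner_omul_left, oinner_oconj_omul_self]
  simp only [oinner_sub_left, oinner_add_left, oinner_smul_left, oinner_comm v u,
    oinner_comm w]
  ring

lemma oinner_tcross_middle (u v w : Octonion) : oinner (tcross u v w) v = 0 := by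
  rw [tcross, oinner_smul_left, oinner_sub_left, oinner_omul_left u, oinner_omul_left w]
  simp only [oinner, omul, oconj, Quaternion.re_mul, Quaternion.imI_mul, Quaternion.imJ_mul,
    Quaternion.imK_mul, Quaternion.re_star, Quaternion.imI_star, Quaternion.imJ_star,
    Quaternion.imK_star, Quaternion.re_sub, Quaternion.imI_sub, Quaternion.imJ_sub,
    Quaternion.imK_sub, Quaternion.re_add, Quaternion.imI_add, Quaternion.imJ_add,
    Quaternion.imK_add, Quaternion.re_neg, Quaternion.imI_neg, Quaternion.imJ_neg,
    Quaternion.imK_neg]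
  ring

lemma oinner_tcross_self (u v w : Octonion) :
    oinner (tcross u v w) (tcross u v w) =
      (Matrix.of fun i j : Fin 3 => oinner (![u, v, w] i) (![u, v, w] j)).det := by
  have hu := oinner_tcross_left u v w
  have hv := oinner_tcross_middle u v w
  have hw := oinner_tcross_right u v w
  have hn : oinner (omul u (omul (oconj v) w)) (omul u (omul (oconj v) w)) =
      oinner u u * (oinner v v * oinner w w) := by
    rw [oinner_omul_self, oinner_omul_self, oinner_oconj]
  have hd : omul u (omul (oconj v) w) = tcross u v w +
      (oinner u v • w + oinner v w • u - oinner u w • v) := by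
    rw [tcross_eq, sub_add_cancel]
  rw [hd] at hn
  simp only [oinner_sub_left, oinner_add_left, oinner_smul_left, oinner_sub_right,
    oinner_add_right, oinner_smul_right, oinner_comm _ (tcross u v w), hu, hv, hw,
    oinner_comm v u, oinner_comm w u, oinner_comm w v] at hn
  simp only [Matrix.det_fin_three, Matrix.of_apply, Matrix.cons_val, oinner_comm v u,
    oinner_comm w u, oinner_comm w v]
  linear_combination hn

lemma cayleyΨ_sq_le (u v w z : Octonion) :
    cayleyΨ u v w z ^ 2 ≤ (Matrix.of fun i j : Fin 4 =>
      oinner (![u, v, w, z] i) (![u, v, w, z] j)).det := by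
  have hP := oinner_tcross_self u v w
  have hu := oinner_tcross_left u v w
  have hv := oinner_tcross_middle u v w
  have hw := oinner_tcross_right u v w
  rw [cayleyΨ]
  generalize tcross u v w = p at *
  by_cases h0 : p = 0
  · have h : oinner p z = 0 := by
      rw [h0, ← zero_smul ℝ (0 : Octonion), oinner_smul_left, zero_mul]
    rw [h, zero_pow two_ne_zero]
    exact det_oinner_nonneg _
  have hp : oinner p p ≠ 0 := mt oinner_self_eq_zero.mp h0
  have h := det_oinner_nonneg ![u, v, w, z - (oinner p z / oinner p p) • p]
  have key : ∀ t : ℝ, t = oinner p z / oinner p p →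
      (Matrix.of fun i j : Fin 4 => oinner (![u, v, w, z - t • p] i)
        (![u, v, w, z - t • p] j)).det =
      (Matrix.of fun i j : Fin 4 => oinner (![u, v, w, z] i) (![u, v, w, z] j)).det -
        oinner p z ^ 2 := by
    intro t ht
    have htp : oinner p z = t * oinner p p := by rw [ht, div_mul_cancel₀ _ hp]
    have hsq : oinner p z ^ 2 = t ^ 2 * oinner p p *
        (Matrix.of fun i j : Fin 3 => oinner (![u, v, w] i) (![u, v, w] j)).det := by
      rw [← hP, htp]; ring
    rw [hsq]
    simp [Matrix.det_succ_row_zero, Fin.sum_univ_succ, Fin.succAbove, oinner_sub_left,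
      oinner_sub_right, oinner_smul_left, oinner_smul_right, oinner_comm _ p, hu, hv, hw, htp]
    ring
  rw [key _ rfl] at h
  linarith

/-- the Cayley calibration inequality `|Ψ(u,v,w,z)| ≤ |u∧v∧w∧z|`,
where `|u∧v∧w∧z|² ` is the Gram determinant of `u, v, w, z`. -/
theorem cayley_calibration_inequality (u v w z : Octonion) :
    |cayleyΨ u v w z| ≤
      Real.sqrt (Matrix.det (Matrix.of fun i j : Fin 4 =>
        oinner (![u, v, w, z] i) (![u, v, w, z] j))) := by
  refine Real.le_sqrt_of_sq_le ?_
  rw [sq_abs]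
  exact cayleyΨ_sq_le u v w z
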